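/- arXiv:1808.09905 — 2 statements merged into one kernel-verified Lean document; each statement's English description precedes it below -/
import Mathlib

section
/- Let C be a path category and let f : A → I, g : B → A be morphisms. The image in the homotopy category Ho(C) of a homotopy full diagram over f, g is a dependent full diagram over [f], [g]. -/
open CategoryTheory CategoryTheory.Limits

universe v u v₂ u₂

namespace Paper

variable {C : Type u} [Category.{v} C]

/-- A weak product of `Z` and `X`: every pair of morphisms into `Z` and `X`
factors (not necessarily uniquely) through the projections. -/
def IsWeakProduct {Z X V : C} (p₁ : V ⟶ Z) (p₂ : V ⟶ X) : Prop :=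
  ∀ {W : C} (a : W ⟶ Z) (b : W ⟶ X), ∃ t : W ⟶ V, t ≫ p₁ = a ∧ t ≫ p₂ = b

/-- `f` is determined by projections with respect to the span `(p₁, p₂)`. -/
def DeterminedByProjections {Z X V Y : C} (p₁ : V ⟶ Z) (p₂ : V ⟶ X) (f : V ⟶ Y) : Prop :=
  ∀ {W : C} (a b : W ⟶ V), a ≫ p₁ = b ≫ p₁ → a ≫ p₂ = b ≫ p₂ → a ≫ f = b ≫ f

/-- A weak pullback of `f` and `g` with projections `q₁`, `q₂`. -/
def IsWeakPullback {P A B Z : C} (q₁ : P ⟶ A) (q₂ : P ⟶ B) (f : A ⟶ Z) (g : B ⟶ Z) : Prop :=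
  q₁ ≫ f = q₂ ≫ g ∧
    ∀ {W : C} (a : W ⟶ A) (b : W ⟶ B), a ≫ f = b ≫ g →
      ∃ t : W ⟶ P, t ≫ q₁ = a ∧ t ≫ q₂ = b

/-- `(W, p₁ : V ⟶ W, p₂ : V ⟶ X, e : V ⟶ Y)` is a weak exponential of `Y` and `X`. -/
def IsWeakExponential {X Y W V : C} (p₁ : V ⟶ W) (p₂ : V ⟶ X) (e : V ⟶ Y) : Prop :=
  IsWeakProduct p₁ p₂ ∧ DeterminedByProjections p₁ p₂ e ∧
    ∀ {W' V' : C} (p₁' : V' ⟶ W') (p₂' : V' ⟶ X) (e' : V' ⟶ Y),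
      IsWeakProduct p₁' p₂' → DeterminedByProjections p₁' p₂' e' →
        ∃ (h : W' ⟶ W) (k : V' ⟶ V), k ≫ p₁ = p₁' ≫ h ∧ k ≫ p₂ = p₂' ∧ k ≫ e = e'

/-- A full diagram from `X` to `Y`. -/
def IsFullDiagram {X Y U V : C} (p₁ : V ⟶ U) (p₂ : V ⟶ X) (f : V ⟶ Y) : Prop :=
  IsWeakProduct p₁ p₂ ∧
    ∀ {U' V' : C} (p₁' : V' ⟶ U') (p₂' : V' ⟶ X) (f' : V' ⟶ Y), IsWeakProduct p₁' p₂' →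
      ∃ (h : U' ⟶ U) (P : C) (q₁ : P ⟶ U') (q₂ : P ⟶ V) (k : P ⟶ V'),
        IsWeakPullback q₁ q₂ h p₁ ∧ k ≫ p₁' = q₁ ∧ k ≫ p₂' = q₂ ≫ p₂ ∧ k ≫ f' = q₂ ≫ f

def HasFullDiagrams (C : Type u) [Category.{v} C] : Prop :=
  ∀ X Y : C, ∃ (U V : C) (p₁ : V ⟶ U) (p₂ : V ⟶ X) (f : V ⟶ Y), IsFullDiagram p₁ p₂ f

def HasWeakExponentials (C : Type u) [Category.{v} C] : Prop :=
  ∀ X Y : C, ∃ (W V : C) (p₁ : V ⟶ W) (p₂ : V ⟶ X) (e : V ⟶ Y), IsWeakExponential p₁ p₂ e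

/-- A dependent full diagram over `x : X ⟶ J` and `y : Y ⟶ X`. -/
def IsDepFullDiagram {J X Y U V : C} (x : X ⟶ J) (y : Y ⟶ X)
    (u : U ⟶ J) (p₁ : V ⟶ U) (p₂ : V ⟶ X) (f : V ⟶ Y) : Prop :=
  IsWeakPullback p₁ p₂ u x ∧ f ≫ y = p₂ ∧
    ∀ {U' V' : C} (u' : U' ⟶ J) (p₁' : V' ⟶ U') (p₂' : V' ⟶ X) (f' : V' ⟶ Y),
      IsWeakPullback p₁' p₂' u' x → f' ≫ y = p₂' →
        ∃ h : U' ⟶ U, h ≫ u = u' ∧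
          ∃ (P : C) (q₁ : P ⟶ V) (q₂ : P ⟶ U') (k : P ⟶ V'),
            IsWeakPullback q₁ q₂ p₁ h ∧ k ≫ p₁' = q₂ ∧ k ≫ f' = q₁ ≫ f

/-- A weak dependent product of `y : Y ⟶ X` and `x : X ⟶ J`. -/
def IsWeakDepProd {J X Y U V : C} (x : X ⟶ J) (y : Y ⟶ X)
    (u : U ⟶ J) (p₁ : V ⟶ U) (p₂ : V ⟶ X) (f : V ⟶ Y) : Prop :=
  IsWeakPullback p₁ p₂ u x ∧ f ≫ y = p₂ ∧ DeterminedByProjections p₁ p₂ f ∧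
    ∀ {U' V' : C} (u' : U' ⟶ J) (p₁' : V' ⟶ U') (p₂' : V' ⟶ X) (f' : V' ⟶ Y),
      IsWeakPullback p₁' p₂' u' x → f' ≫ y = p₂' →
        ∃ (h : U' ⟶ U) (k : V' ⟶ V),
          h ≫ u = u' ∧ k ≫ p₁ = p₁' ≫ h ∧ k ≫ p₂ = p₂' ∧ k ≫ f = f'

def HasDepFullDiagrams (C : Type u) [Category.{v} C] : Prop :=
  ∀ {J X Y : C} (x : X ⟶ J) (y : Y ⟶ X),
    ∃ (U V : C) (u : U ⟶ J) (p₁ : V ⟶ U) (p₂ : V ⟶ X) (f : V ⟶ Y),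
      IsDepFullDiagram x y u p₁ p₂ f

def HasWeakDepProds (C : Type u) [Category.{v} C] : Prop :=
  ∀ {J X Y : C} (x : X ⟶ J) (y : Y ⟶ X),
    ∃ (U V : C) (u : U ⟶ J) (p₁ : V ⟶ U) (p₂ : V ⟶ X) (f : V ⟶ Y),
      IsWeakDepProd x y u p₁ p₂ f

/-- A category has weak finite limits if every finite diagram admits a weak limit,
i.e. a cone through which every cone factors (not necessarily uniquely). -/
def HasWeakFiniteLimits (C : Type u) [Category.{v} C] : Prop :=
  ∀ (J : Type) (_ : SmallCategory J) (_ : FinCategory J) (F : J ⥤ C),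
    ∃ c : Cone F, ∀ d : Cone F, Nonempty (d ⟶ c)

end Paper
namespace Paper

variable {C : Type u} [Category.{v} C]

/-- A fibrewise path object for `g : B ⟶ A` with respect to classes `Weq` of weak
equivalences and `Fib` of fibrations: a factorisation of the fibrewise diagonal
`B ⟶ B ×_A B` into a weak equivalence followed by a fibration. -/
structure FibPathObj (Weq Fib : MorphismProperty C) {B A : C} (g : B ⟶ A) where
  P : C
  r : B ⟶ P
  π₁ : P ⟶ B
  π₂ : P ⟶ B
  weq_r : Weq r
  w : π₁ ≫ g = π₂ ≫ g
  r_π₁ : r ≫ π₁ = 𝟙 B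
  r_π₂ : r ≫ π₂ = 𝟙 B
  fib : ∀ {Q : C} (q₁ q₂ : Q ⟶ B), IsPullback q₁ q₂ g g →
    ∀ t : P ⟶ Q, t ≫ q₁ = π₁ → t ≫ q₂ = π₂ → Fib t

/-- `k` and `k'` are fibrewise (right) homotopic over `g`. -/
def FibrewiseHomotopic (Weq Fib : MorphismProperty C) {X B A : C} (g : B ⟶ A)
    (k k' : X ⟶ B) : Prop :=
  ∃ (po : FibPathObj Weq Fib g) (H : X ⟶ po.P), H ≫ po.π₁ = k ∧ H ≫ po.π₂ = k'

/-- Two maps are (right) homotopic if they are fibrewise homotopic over the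
terminal map. -/
def Homotopic (Weq Fib : MorphismProperty C) [HasTerminal C] {X B : C}
    (k k' : X ⟶ B) : Prop :=
  FibrewiseHomotopic Weq Fib (terminal.from B) k k'

/-- A homotopy equivalence. -/
def IsHomotopyEquiv (Weq Fib : MorphismProperty C) [HasTerminal C] {A B : C}
    (h : A ⟶ B) : Prop :=
  ∃ k : B ⟶ A, Homotopic Weq Fib (h ≫ k) (𝟙 A) ∧ Homotopic Weq Fib (k ≫ h) (𝟙 B)

/-- The square `(q₁, q₂)` over `f, g` (commuting up to homotopy) is a homotopy
pullback: the comparison map into the standard homotopy pullback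
`X ×_Z PZ ×_Z Y` is a homotopy equivalence. -/
def IsHomotopyPullback (Weq Fib : MorphismProperty C) [HasTerminal C]
    {X Y Z Q : C} (f : X ⟶ Z) (g : Y ⟶ Z) (q₁ : Q ⟶ X) (q₂ : Q ⟶ Y) : Prop :=
  ∃ (po : FibPathObj Weq Fib (terminal.from Z)) (W : C)
      (a : W ⟶ X) (b : W ⟶ Y) (c : W ⟶ po.P),
    c ≫ po.π₁ = a ≫ f ∧ c ≫ po.π₂ = b ≫ g ∧
    (∀ {V : C} (a' : V ⟶ X) (b' : V ⟶ Y) (c' : V ⟶ po.P),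
      c' ≫ po.π₁ = a' ≫ f → c' ≫ po.π₂ = b' ≫ g →
        ∃! t : V ⟶ W, t ≫ a = a' ∧ t ≫ b = b' ∧ t ≫ c = c') ∧
    ∃ h : Q ⟶ po.P, h ≫ po.π₁ = q₁ ≫ f ∧ h ≫ po.π₂ = q₂ ≫ g ∧
      ∀ t : Q ⟶ W, t ≫ a = q₁ → t ≫ b = q₂ → t ≫ c = h → IsHomotopyEquiv Weq Fib t

/-- A homotopy weak dependent product (weak homotopy Π-type) of the fibrations
`f : A ⟶ I` and `g : B ⟶ A`. -/
def IsHomotopyWeakDepProd (Weq Fib : MorphismProperty C) {I A B U V : C}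
    (f : A ⟶ I) (g : B ⟶ A)
    (u : U ⟶ I) (p₁ : V ⟶ U) (p₂ : V ⟶ A) (e : V ⟶ B) : Prop :=
  Fib u ∧ IsPullback p₁ p₂ u f ∧ e ≫ g = p₂ ∧
    ∀ {U' V' : C} (u' : U' ⟶ I) (p₁' : V' ⟶ U') (p₂' : V' ⟶ A) (e' : V' ⟶ B),
      IsPullback p₁' p₂' u' f → e' ≫ g = p₂' →
        ∃ k : U' ⟶ U, k ≫ u = u' ∧
          ∀ m : V' ⟶ V, m ≫ p₁ = p₁' ≫ k → m ≫ p₂ = p₂' →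
            FibrewiseHomotopic Weq Fib g (m ≫ e) e'

end Paper
namespace Paper

variable {C : Type u} [Category.{v} C]

/-- A path category (category of fibrant objects in which every acyclic
fibration has a section), à la van den Berg–Moerdijk. -/
structure PathCatStruct (C : Type u) [Category.{v} C] [HasTerminal C] where
  Fib : MorphismProperty C
  Weq : MorphismProperty C
  fib_iso : ∀ {X Y : C} (f : X ⟶ Y), IsIso f → Fib f
  weq_iso : ∀ {X Y : C} (f : X ⟶ Y), IsIso f → Weq f
  fib_comp : ∀ {X Y Z : C} (f : X ⟶ Y) (g : Y ⟶ Z), Fib f → Fib g → Fib (f ≫ g)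
  weq_comp : ∀ {X Y Z : C} (f : X ⟶ Y) (g : Y ⟶ Z), Weq f → Weq g → Weq (f ≫ g)
  weq_two_out_of_six : ∀ {X Y Z T : C} (f : X ⟶ Y) (g : Y ⟶ Z) (h : Z ⟶ T),
    Weq (f ≫ g) → Weq (g ≫ h) →
      Weq f ∧ Weq g ∧ Weq h ∧ Weq (f ≫ g ≫ h)
  fib_terminal : ∀ X : C, Fib (terminal.from X)
  pullback_exists : ∀ {X Y Z : C} (f : X ⟶ Z) (g : Y ⟶ Z), Fib g →
    ∃ (P : C) (p₁ : P ⟶ X) (p₂ : P ⟶ Y), IsPullback p₁ p₂ f g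
  fib_stable : ∀ {X Y Z P : C} (f : X ⟶ Z) (g : Y ⟶ Z) (p₁ : P ⟶ X) (p₂ : P ⟶ Y),
    IsPullback p₁ p₂ f g → Fib g → Fib p₁
  acyc_fib_stable : ∀ {X Y Z P : C} (f : X ⟶ Z) (g : Y ⟶ Z) (p₁ : P ⟶ X) (p₂ : P ⟶ Y),
    IsPullback p₁ p₂ f g → Fib g → Weq g → Weq p₁
  acyc_fib_section : ∀ {X Y : C} (f : X ⟶ Y), Fib f → Weq f →
    ∃ s : Y ⟶ X, s ≫ f = 𝟙 Y
  path_obj : ∀ X : C, Nonempty (FibPathObj Weq Fib (terminal.from X))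

/-- A homotopy full diagram over `f : A ⟶ I`, `g : B ⟶ A`. -/
def IsHomotopyFullDiagram (Weq Fib : MorphismProperty C) [HasTerminal C]
    {I A B U V : C} (f : A ⟶ I) (g : B ⟶ A)
    (u : U ⟶ I) (p₁ : V ⟶ U) (p₂ : V ⟶ A) (e : V ⟶ B) : Prop :=
  Homotopic Weq Fib (p₁ ≫ u) (p₂ ≫ f) ∧
  IsHomotopyPullback Weq Fib u f p₁ p₂ ∧
  Homotopic Weq Fib (e ≫ g) p₂ ∧
    ∀ {U' V' : C} (u' : U' ⟶ I) (p₁' : V' ⟶ U') (p₂' : V' ⟶ A) (e' : V' ⟶ B),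
      Homotopic Weq Fib (p₁' ≫ u') (p₂' ≫ f) →
      IsHomotopyPullback Weq Fib u' f p₁' p₂' →
      Homotopic Weq Fib (e' ≫ g) p₂' →
        ∃ h : U' ⟶ U, Homotopic Weq Fib (h ≫ u) u' ∧
          ∃ (P : C) (q₁ : P ⟶ V) (q₂ : P ⟶ U'),
            Homotopic Weq Fib (q₁ ≫ p₁) (q₂ ≫ h) ∧
            IsHomotopyPullback Weq Fib p₁ h q₁ q₂ ∧
            ∃ k : P ⟶ V', Homotopic Weq Fib (k ≫ p₁') q₂ ∧
              Homotopic Weq Fib (k ≫ e') (q₁ ≫ e)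

end Paper
namespace Paper

/-- The homotopy relation of a path category, as a `HomRel`; the homotopy
category is the quotient of the path category by this relation. -/
def homotopyHomRel {C : Type u} [Category.{v} C] [HasTerminal C]
    (S : PathCatStruct C) : HomRel C :=
  fun {_ _} f' g' => Homotopic S.Weq S.Fib f' g'

namespace PathCatStruct

variable {C : Type u} [Category.{v} C] [HasTerminal C] (S : PathCatStruct C)

theorem weq_of_comp_right {X Y Z : C} (f : X ⟶ Y) (g : Y ⟶ Z)
    (hg : S.Weq g) (h : S.Weq (f ≫ g)) : S.Weq f :=
  (S.weq_two_out_of_six f g (𝟙 Z) h (by simpa using hg)).1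

theorem weq_of_comp_left {X Y Z : C} (f : X ⟶ Y) (g : Y ⟶ Z)
    (hf : S.Weq f) (h : S.Weq (f ≫ g)) : S.Weq g :=
  (S.weq_two_out_of_six (𝟙 X) f g (by simpa using hf) h).2.2.1

theorem weq_id (X : C) : S.Weq (𝟙 X) := S.weq_iso _ inferInstance

theorem exists_prod (S : PathCatStruct C) (X Y : C) : ∃ (P : C) (p₁ : P ⟶ X) (p₂ : P ⟶ Y),
    IsPullback p₁ p₂ (terminal.from X) (terminal.from Y) :=
  S.pullback_exists _ _ (S.fib_terminal Y)

theorem fib_prod_fst {X Y P : C} {p₁ : P ⟶ X} {p₂ : P ⟶ Y}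
    (h : IsPullback p₁ p₂ (terminal.from X) (terminal.from Y)) : S.Fib p₁ :=
  S.fib_stable _ _ _ _ h (S.fib_terminal Y)

theorem fib_prod_snd {X Y P : C} {p₁ : P ⟶ X} {p₂ : P ⟶ Y}
    (h : IsPullback p₁ p₂ (terminal.from X) (terminal.from Y)) : S.Fib p₂ :=
  S.fib_prod_fst h.flip

theorem weq_π₁ {X : C} (po : FibPathObj S.Weq S.Fib (terminal.from X)) : S.Weq po.π₁ :=
  S.weq_of_comp_left po.r po.π₁ po.weq_r (by rw [po.r_π₁]; exact S.weq_id X)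

theorem fib_π₁ {X : C} (po : FibPathObj S.Weq S.Fib (terminal.from X)) : S.Fib po.π₁ := by
  obtain ⟨Q, q₁, q₂, hQ⟩ := S.exists_prod X X
  have ht := po.fib q₁ q₂ hQ (hQ.lift po.π₁ po.π₂ po.w) (by simp) (by simp)
  simpa using S.fib_comp _ _ ht (S.fib_prod_fst hQ)

/-- The standard homotopy pullback `X ×_Z PZ ×_Z Y` exists and fibres over the product of `X`
and `Y`. -/
theorem exists_stdHomotopyPullback {X Y Z : C} (x : X ⟶ Z) (y : Y ⟶ Z)
    (po : FibPathObj S.Weq S.Fib (terminal.from Z)) :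
    ∃ (R : C) (a₁ : R ⟶ X) (a₂ : R ⟶ Y) (W : C) (d : W ⟶ R) (c : W ⟶ po.P),
      IsPullback a₁ a₂ (terminal.from X) (terminal.from Y) ∧ S.Fib d ∧
      c ≫ po.π₁ = (d ≫ a₁) ≫ x ∧ c ≫ po.π₂ = (d ≫ a₂) ≫ y ∧
      ∀ {V : C} (a' : V ⟶ X) (b' : V ⟶ Y) (c' : V ⟶ po.P),
        c' ≫ po.π₁ = a' ≫ x → c' ≫ po.π₂ = b' ≫ y →
          ∃! t : V ⟶ W, t ≫ d ≫ a₁ = a' ∧ t ≫ d ≫ a₂ = b' ∧ t ≫ c = c' := by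
  obtain ⟨Q, q₁, q₂, hQ⟩ := S.exists_prod Z Z
  obtain ⟨R, a₁, a₂, hR⟩ := S.exists_prod X Y
  obtain ⟨t, ht₁, ht₂⟩ : ∃ t : po.P ⟶ Q, t ≫ q₁ = po.π₁ ∧ t ≫ q₂ = po.π₂ :=
    ⟨hQ.lift po.π₁ po.π₂ po.w, by simp, by simp⟩
  obtain ⟨m, hm₁, hm₂⟩ : ∃ m : R ⟶ Q, m ≫ q₁ = a₁ ≫ x ∧ m ≫ q₂ = a₂ ≫ y :=
    ⟨hQ.lift (a₁ ≫ x) (a₂ ≫ y) (Subsingleton.elim _ _), by simp, by simp⟩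
  have ht := po.fib q₁ q₂ hQ t ht₁ ht₂
  obtain ⟨W, d, c, hW⟩ := S.pullback_exists m t ht
  refine ⟨R, a₁, a₂, W, d, c, hR, S.fib_stable _ _ _ _ hW ht, ?_, ?_, ?_⟩
  · rw [← ht₁, ← Category.assoc, ← hW.w, Category.assoc, hm₁, Category.assoc]
  · rw [← ht₂, ← Category.assoc, ← hW.w, Category.assoc, hm₂, Category.assoc]
  · intro V a' b' c' h₁ h₂
    have hw : hR.lift a' b' (Subsingleton.elim _ _) ≫ m = c' ≫ t := by
      apply hQ.hom_ext
      · rw [Category.assoc, Category.assoc, hm₁, ht₁, h₁, IsPullback.lift_fst_assoc]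
      · rw [Category.assoc, Category.assoc, hm₂, ht₂, h₂, IsPullback.lift_snd_assoc]
    refine ⟨hW.lift _ _ hw, ⟨by simp, by simp, by simp⟩, ?_⟩
    rintro s ⟨rfl, rfl, rfl⟩
    apply hW.hom_ext
    · apply hR.hom_ext <;> simp
    · simp

/-- Every morphism factors as a weak equivalence followed by a fibration. -/
theorem exists_factorisation {A X : C} (f : A ⟶ X) :
    ∃ (A' : C) (w : A ⟶ A') (p : A' ⟶ X), S.Weq w ∧ S.Fib p ∧ w ≫ p = f := by
  obtain ⟨po⟩ := S.path_obj X
  obtain ⟨R, a₁, a₂, W, d, c, hR, hd, hc₁, hc₂, hW⟩ :=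
    S.exists_stdHomotopyPullback f (𝟙 X) po
  rw [Category.comp_id] at hc₂
  have hpb : IsPullback (d ≫ a₁) c f po.π₁ := by
    refine ⟨⟨hc₁.symm⟩, ⟨PullbackCone.IsLimit.mk _
      (fun s => (hW s.fst (s.snd ≫ po.π₂) s.snd s.condition.symm (by simp)).choose)
      (fun s => (hW s.fst (s.snd ≫ po.π₂) s.snd s.condition.symm (by simp)).choose_spec.1.1)
      (fun s => (hW s.fst (s.snd ≫ po.π₂) s.snd s.condition.symm (by simp)).choose_spec.1.2.2)
      (fun s m hm₁ hm₂ =>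
        (hW s.fst (s.snd ≫ po.π₂) s.snd s.condition.symm (by simp)).choose_spec.2 m
          ⟨hm₁, by rw [← hc₂, ← hm₂, Category.assoc], hm₂⟩)⟩⟩
  have hweq : S.Weq (d ≫ a₁) := S.acyc_fib_stable _ _ _ _ hpb (S.fib_π₁ po) (S.weq_π₁ po)
  obtain ⟨w, ⟨hw₁, hw₂, -⟩, -⟩ := hW (𝟙 A) f (f ≫ po.r) (by simp [po.r_π₁]) (by simp [po.r_π₂])
  exact ⟨W, w, d ≫ a₂, S.weq_of_comp_right w (d ≫ a₁) hweq (by rw [hw₁]; exact S.weq_id A),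
    S.fib_comp _ _ hd (S.fib_prod_snd hR), hw₂⟩

/-- A commutative square from a weak equivalence to a fibration has a diagonal making the lower
triangle commute. -/
theorem exists_lower_filler {A B X Y : C} (w : A ⟶ B) (p : X ⟶ Y) (a : A ⟶ X) (b : B ⟶ Y)
    (hw : S.Weq w) (hp : S.Fib p) (h : a ≫ p = w ≫ b) : ∃ l : B ⟶ X, l ≫ p = b := by
  obtain ⟨X', p', x, hX'⟩ := S.pullback_exists b p hp
  obtain ⟨A', w', q, hw', hq, hfac⟩ := S.exists_factorisation (hX'.lift w a h.symm)
  have hcomp : w' ≫ q ≫ p' = w := by rw [← Category.assoc, hfac, IsPullback.lift_fst]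
  obtain ⟨s, hs⟩ := S.acyc_fib_section (q ≫ p')
    (S.fib_comp _ _ hq (S.fib_stable _ _ _ _ hX' hp))
    (S.weq_of_comp_left w' _ hw' (by rwa [hcomp]))
  refine ⟨s ≫ q ≫ x, ?_⟩
  simp only [Category.assoc] at hs ⊢
  rw [← hX'.w, ← Category.assoc q, ← Category.assoc s, hs, Category.id_comp]

/-- Two maps equalised by a weak equivalence are homotopic through any given path object. -/
theorem exists_homotopy_of_weq {A T X : C} (w : A ⟶ T) (hw : S.Weq w) (t₁ t₂ : T ⟶ X)
    (h : w ≫ t₁ = w ≫ t₂) (po : FibPathObj S.Weq S.Fib (terminal.from X)) :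
    ∃ l : T ⟶ po.P, l ≫ po.π₁ = t₁ ∧ l ≫ po.π₂ = t₂ := by
  obtain ⟨Q, q₁, q₂, hQ⟩ := S.exists_prod X X
  have ht := po.fib q₁ q₂ hQ (hQ.lift po.π₁ po.π₂ po.w) (by simp) (by simp)
  obtain ⟨l, hl⟩ := S.exists_lower_filler w _ (w ≫ t₁ ≫ po.r)
    (hQ.lift t₁ t₂ (Subsingleton.elim _ _)) hw ht
    (by apply hQ.hom_ext <;> simp [po.r_π₁, po.r_π₂, h])
  refine ⟨l, ?_, ?_⟩
  · simpa using congrArg (· ≫ q₁) hl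
  · simpa using congrArg (· ≫ q₂) hl

variable {S}

theorem exists_homotopy {X Y : C} {k k' : X ⟶ Y} (h : Homotopic S.Weq S.Fib k k')
    (po : FibPathObj S.Weq S.Fib (terminal.from Y)) :
    ∃ H : X ⟶ po.P, H ≫ po.π₁ = k ∧ H ≫ po.π₂ = k' := by
  obtain ⟨po', H, rfl, rfl⟩ := h
  obtain ⟨l, hl₁, hl₂⟩ := S.exists_homotopy_of_weq po'.r po'.weq_r po'.π₁ po'.π₂
    (by rw [po'.r_π₁, po'.r_π₂]) po
  exact ⟨H ≫ l, by rw [Category.assoc, hl₁], by rw [Category.assoc, hl₂]⟩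

theorem homotopic_of_weq {A T X : C} (w : A ⟶ T) (hw : S.Weq w) {t₁ t₂ : T ⟶ X}
    (h : w ≫ t₁ = w ≫ t₂) : Homotopic S.Weq S.Fib t₁ t₂ := by
  obtain ⟨po⟩ := S.path_obj X
  obtain ⟨l, hl⟩ := S.exists_homotopy_of_weq w hw t₁ t₂ h po
  exact ⟨po, l, hl⟩

theorem homotopic_refl {X Y : C} (k : X ⟶ Y) : Homotopic S.Weq S.Fib k k :=
  homotopic_of_weq (𝟙 X) (S.weq_id X) rfl

theorem homotopic_precomp {W X Y : C} (a : W ⟶ X) {k k' : X ⟶ Y}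
    (h : Homotopic S.Weq S.Fib k k') : Homotopic S.Weq S.Fib (a ≫ k) (a ≫ k') := by
  obtain ⟨po, H, rfl, rfl⟩ := h
  exact ⟨po, a ≫ H, by simp, by simp⟩

theorem homotopic_postcomp {X Y Z : C} {k k' : X ⟶ Y} (b : Y ⟶ Z)
    (h : Homotopic S.Weq S.Fib k k') : Homotopic S.Weq S.Fib (k ≫ b) (k' ≫ b) := by
  obtain ⟨po, H, rfl, rfl⟩ := h
  have hπ : Homotopic S.Weq S.Fib (po.π₁ ≫ b) (po.π₂ ≫ b) :=
    homotopic_of_weq po.r po.weq_r (by rw [reassoc_of% po.r_π₁, reassoc_of% po.r_π₂])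
  simpa using homotopic_precomp H hπ

theorem homotopic_symm {X Y : C} {k k' : X ⟶ Y} (h : Homotopic S.Weq S.Fib k k') :
    Homotopic S.Weq S.Fib k' k := by
  obtain ⟨po, H, rfl, rfl⟩ := h
  exact homotopic_precomp H (homotopic_of_weq po.r po.weq_r (by rw [po.r_π₁, po.r_π₂]))

theorem homotopic_trans {X Y : C} {k₁ k₂ k₃ : X ⟶ Y} (h : Homotopic S.Weq S.Fib k₁ k₂)
    (h' : Homotopic S.Weq S.Fib k₂ k₃) : Homotopic S.Weq S.Fib k₁ k₃ := by
  obtain ⟨po, H, rfl, rfl⟩ := h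
  obtain ⟨H', hH', rfl⟩ := exists_homotopy h' po
  obtain ⟨T, t₁, t₂, hT⟩ := S.pullback_exists po.π₂ po.π₁ (S.fib_π₁ po)
  have ht₁ : S.Weq t₁ := S.acyc_fib_stable _ _ _ _ hT (S.fib_π₁ po) (S.weq_π₁ po)
  have hr : po.r ≫ po.π₂ = po.r ≫ po.π₁ := by rw [po.r_π₁, po.r_π₂]
  have hw : S.Weq (hT.lift po.r po.r hr) :=
    S.weq_of_comp_right _ t₁ ht₁ (by rw [IsPullback.lift_fst]; exact po.weq_r)
  have hπ : Homotopic S.Weq S.Fib (t₁ ≫ po.π₁) (t₂ ≫ po.π₂) :=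
    homotopic_of_weq _ hw (by simp [po.r_π₁, po.r_π₂])
  simpa using homotopic_precomp (hT.lift H H' hH'.symm) hπ

instance congruence_homotopyHomRel : Congruence (homotopyHomRel S) where
  equivalence := ⟨homotopic_refl, homotopic_symm, homotopic_trans⟩
  comp_left a _ _ h := homotopic_precomp a h
  comp_right b h := homotopic_postcomp b h

theorem map_eq_iff {X Y : C} {k k' : X ⟶ Y} :
    (Quotient.functor (homotopyHomRel S)).map k = (Quotient.functor (homotopyHomRel S)).map k' ↔
      Homotopic S.Weq S.Fib k k' :=
  Quotient.functor_map_eq_iff _ _ _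

/-- Homotopy pullbacks become weak pullbacks in the homotopy category. -/
theorem isWeakPullback_map {X Y Z Q : C} {x : X ⟶ Z} {y : Y ⟶ Z} {q₁ : Q ⟶ X} {q₂ : Q ⟶ Y}
    (h : IsHomotopyPullback S.Weq S.Fib x y q₁ q₂) :
    IsWeakPullback ((Quotient.functor (homotopyHomRel S)).map q₁)
      ((Quotient.functor (homotopyHomRel S)).map q₂)
      ((Quotient.functor (homotopyHomRel S)).map x)
      ((Quotient.functor (homotopyHomRel S)).map y) := by
  obtain ⟨po, W, a, b, c, -, -, huniv, H, hH₁, hH₂, heq⟩ := h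
  refine ⟨?_, ?_⟩
  · rw [← Functor.map_comp, ← Functor.map_comp, map_eq_iff]
    exact ⟨po, H, hH₁, hH₂⟩
  · rintro ⟨T⟩ s s' hs
    obtain ⟨s, rfl⟩ := (Quotient.functor (homotopyHomRel S)).map_surjective (X := T) s
    obtain ⟨s', rfl⟩ := (Quotient.functor (homotopyHomRel S)).map_surjective (X := T) s'
    rw [← Functor.map_comp, ← Functor.map_comp, map_eq_iff] at hs
    obtain ⟨K, hK₁, hK₂⟩ := exists_homotopy hs po
    obtain ⟨l, ⟨hl₁, hl₂, -⟩, -⟩ := huniv s s' K hK₁ hK₂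
    obtain ⟨t, ⟨ht₁, ht₂, ht₃⟩, -⟩ := huniv q₁ q₂ H hH₁ hH₂
    obtain ⟨i, -, hi⟩ := heq t ht₁ ht₂ ht₃
    refine ⟨(Quotient.functor (homotopyHomRel S)).map (l ≫ i), ?_, ?_⟩
    · rw [← Functor.map_comp, map_eq_iff, ← hl₁, ← ht₁]
      simpa using homotopic_precomp l (homotopic_postcomp a hi)
    · rw [← Functor.map_comp, map_eq_iff, ← hl₂, ← ht₂]
      simpa using homotopic_precomp l (homotopic_postcomp b hi)

theorem exists_isHomotopyPullback (S : PathCatStruct C) {X Y Z : C} (x : X ⟶ Z) (y : Y ⟶ Z) :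
    ∃ (W : C) (a : W ⟶ X) (b : W ⟶ Y), Homotopic S.Weq S.Fib (a ≫ x) (b ≫ y) ∧
      IsHomotopyPullback S.Weq S.Fib x y a b := by
  obtain ⟨po⟩ := S.path_obj Z
  obtain ⟨R, a₁, a₂, W, d, c, -, -, hc₁, hc₂, hW⟩ := S.exists_stdHomotopyPullback x y po
  refine ⟨W, d ≫ a₁, d ≫ a₂, ⟨po, c, hc₁, hc₂⟩,
    po, W, d ≫ a₁, d ≫ a₂, c, hc₁, hc₂, hW, c, hc₁, hc₂, fun t h₁ h₂ h₃ => ?_⟩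
  obtain rfl : t = 𝟙 W :=
    (hW _ _ c hc₁ hc₂).unique ⟨h₁, h₂, h₃⟩ ⟨by simp, by simp, by simp⟩
  exact ⟨𝟙 W, by simpa using homotopic_refl _, by simpa using homotopic_refl _⟩

end PathCatStruct

/-- The image in the homotopy category `Ho(C)` of a homotopy
full diagram over `f, g` in a path category `C` is a dependent full diagram
over `[f], [g]`. -/
theorem image_homotopyFullDiagram_isDepFullDiagram
    {C : Type u} [Category.{v} C] [HasTerminal C] (S : PathCatStruct C)
    {I A B U V : C} (f : A ⟶ I) (g : B ⟶ A)
    (u : U ⟶ I) (p₁ : V ⟶ U) (p₂ : V ⟶ A) (e : V ⟶ B)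
    (hfd : IsHomotopyFullDiagram S.Weq S.Fib f g u p₁ p₂ e) :
    IsDepFullDiagram
      ((Quotient.functor (homotopyHomRel S)).map f)
      ((Quotient.functor (homotopyHomRel S)).map g)
      ((Quotient.functor (homotopyHomRel S)).map u)
      ((Quotient.functor (homotopyHomRel S)).map p₁)
      ((Quotient.functor (homotopyHomRel S)).map p₂)
      ((Quotient.functor (homotopyHomRel S)).map e) := by
  obtain ⟨-, hpb, he, huniv⟩ := hfd
  refine ⟨PathCatStruct.isWeakPullback_map hpb, ?_, ?_⟩
  · rwa [← Functor.map_comp, PathCatStruct.map_eq_iff]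
  · rintro ⟨U'⟩ ⟨V'⟩ u' p₁' p₂' e' ⟨-, hV'⟩ he'
    obtain ⟨u', rfl⟩ := (Quotient.functor (homotopyHomRel S)).map_surjective (X := U') u'
    obtain ⟨p₁', rfl⟩ :=
      (Quotient.functor (homotopyHomRel S)).map_surjective (X := V') (Y := U') p₁'
    obtain ⟨p₂', rfl⟩ := (Quotient.functor (homotopyHomRel S)).map_surjective (X := V') p₂'
    obtain ⟨e', rfl⟩ := (Quotient.functor (homotopyHomRel S)).map_surjective (X := V') e'
    obtain ⟨W, a, b, hab, hW⟩ := S.exists_isHomotopyPullback u' f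
    obtain ⟨t, ht₁, ht₂⟩ := hV' ((Quotient.functor (homotopyHomRel S)).map a)
      ((Quotient.functor (homotopyHomRel S)).map b)
      (by rwa [← Functor.map_comp, ← Functor.map_comp, PathCatStruct.map_eq_iff])
    obtain ⟨t, rfl⟩ :=
      (Quotient.functor (homotopyHomRel S)).map_surjective (X := W) (Y := V') t
    obtain ⟨h, hh, P, q₁, q₂, -, hP, k, hk₁, hk₂⟩ := huniv u' a b (t ≫ e') hab hW (by
      rw [← PathCatStruct.map_eq_iff, Category.assoc, Functor.map_comp, Functor.map_comp,
        he', ht₂])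
    rw [← PathCatStruct.map_eq_iff, Functor.map_comp] at hh hk₁
    rw [← PathCatStruct.map_eq_iff, Functor.map_comp, Functor.map_comp, Functor.map_comp] at hk₂
    refine ⟨(Quotient.functor (homotopyHomRel S)).map h, hh, _,
      (Quotient.functor (homotopyHomRel S)).map q₁, (Quotient.functor (homotopyHomRel S)).map q₂,
      (Quotient.functor (homotopyHomRel S)).map k ≫ (Quotient.functor (homotopyHomRel S)).map t,
      PathCatStruct.isWeakPullback_map hP, ?_, ?_⟩
    · rw [Category.assoc, ht₁, hk₁]
    · rw [Category.assoc, hk₂]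

end Paper
end

section
/- Let E be an exact category with a projective cover P and let Z, X, Y be objects of P. There is an isomorphism between the poset Sub_E(Z × X × Y) of subobjects of Z × X × Y in E and the poset reflection of the category of spans in P over Z, X and Y (objects: an object V of P with morphisms V → Z, V → X, V → Y; morphisms: morphisms commuting with the three legs). Moreover, this isomorphism restricts to an isomorphism between the subobjects R ↪ Z × X × Y whose composite R → Z × X is a regular epimorphism and the spans whose legs V → Z, V → X form a weak product of Z and X; and it restricts further to an isomorphism between the subobjects with R → Z × X an isomorphism and the spans whose legs to Z and X form a weak product and whose leg V → Y is determined by projections. -/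
open CategoryTheory CategoryTheory.Limits

universe v u v₂ u₂

namespace Paper

variable {E : Type u} [Category.{v} E]

/-- An internal equivalence relation, expressed via generalized elements:
the pair `(r₁, r₂)` is jointly monic, reflexive, symmetric and transitive. -/
def IsInternalEquivRel {R X : E} (r₁ r₂ : R ⟶ X) : Prop :=
  (∀ {W : E} (a b : W ⟶ R), a ≫ r₁ = b ≫ r₁ → a ≫ r₂ = b ≫ r₂ → a = b) ∧
  (∀ {W : E} (x : W ⟶ X), ∃ d : W ⟶ R, d ≫ r₁ = x ∧ d ≫ r₂ = x) ∧
  (∀ {W : E} (a : W ⟶ R), ∃ b : W ⟶ R, b ≫ r₁ = a ≫ r₂ ∧ b ≫ r₂ = a ≫ r₁) ∧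
  (∀ {W : E} (a b : W ⟶ R), a ≫ r₂ = b ≫ r₁ →
    ∃ c : W ⟶ R, c ≫ r₁ = a ≫ r₁ ∧ c ≫ r₂ = b ≫ r₂)

/-- A Barr-exact category: a regular category (finite limits together with
pullback-stable regular epi–mono factorisations) in which every internal
equivalence relation is effective (is a kernel pair). -/
class ExactCategory (E : Type u) [Category.{v} E] : Prop where
  hasFiniteLimits : HasFiniteLimits E
  regEpiMonoFactorisation : ∀ {A B : E} (f : A ⟶ B),
    ∃ (I : E) (e : A ⟶ I) (m : I ⟶ B), Nonempty (RegularEpi e) ∧ Mono m ∧ e ≫ m = f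
  regEpiStable : ∀ {A B X P : E} (f : A ⟶ B) (g : X ⟶ B) (p₁ : P ⟶ A) (p₂ : P ⟶ X),
    IsPullback p₁ p₂ f g → Nonempty (RegularEpi f) → Nonempty (RegularEpi p₂)
  equivRelEffective : ∀ {R X : E} (r₁ r₂ : R ⟶ X), IsInternalEquivRel r₁ r₂ →
    ∃ (Y : E) (q : X ⟶ Y), IsKernelPair q r₁ r₂

attribute [instance] ExactCategory.hasFiniteLimits

/-- `P` is (the object class of) a projective cover of `E`: every object satisfying `P`
is regular projective and every object of `E` is covered by a regular epi from an
object satisfying `P`. -/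
def IsProjectiveCover (P : E → Prop) : Prop :=
  (∀ {X : E}, P X → ∀ {A B : E} (g : A ⟶ B), Nonempty (RegularEpi g) →
    ∀ f : X ⟶ B, ∃ f' : X ⟶ A, f' ≫ g = f) ∧
  (∀ A : E, ∃ (X : E) (p : X ⟶ A), P X ∧ Nonempty (RegularEpi p))

section Relative

variable (P : E → Prop)

/-- Weak product relative to the full subcategory on `P`. -/
def IsWeakProductOn {Z X V : E} (p₁ : V ⟶ Z) (p₂ : V ⟶ X) : Prop :=
  ∀ {W : E}, P W → ∀ (a : W ⟶ Z) (b : W ⟶ X), ∃ t : W ⟶ V, t ≫ p₁ = a ∧ t ≫ p₂ = b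

/-- Determined by projections, relative to the full subcategory on `P`. -/
def DeterminedByProjectionsOn {Z X V Y : E} (p₁ : V ⟶ Z) (p₂ : V ⟶ X) (f : V ⟶ Y) : Prop :=
  ∀ {W : E}, P W → ∀ (a b : W ⟶ V), a ≫ p₁ = b ≫ p₁ → a ≫ p₂ = b ≫ p₂ → a ≫ f = b ≫ f

/-- Weak pullback relative to the full subcategory on `P`. -/
def IsWeakPullbackOn {Q A B Z : E} (q₁ : Q ⟶ A) (q₂ : Q ⟶ B) (f : A ⟶ Z) (g : B ⟶ Z) : Prop :=
  q₁ ≫ f = q₂ ≫ g ∧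
    ∀ {W : E}, P W → ∀ (a : W ⟶ A) (b : W ⟶ B), a ≫ f = b ≫ g →
      ∃ t : W ⟶ Q, t ≫ q₁ = a ∧ t ≫ q₂ = b

/-- Full diagram from `X` to `Y` relative to the full subcategory on `P`. -/
def IsFullDiagramOn {X Y U V : E} (p₁ : V ⟶ U) (p₂ : V ⟶ X) (f : V ⟶ Y) : Prop :=
  IsWeakProductOn P p₁ p₂ ∧
    ∀ {U' V' : E}, P U' → P V' → ∀ (p₁' : V' ⟶ U') (p₂' : V' ⟶ X) (f' : V' ⟶ Y),
      IsWeakProductOn P p₁' p₂' →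
        ∃ (h : U' ⟶ U) (Q : E) (_ : P Q) (q₁ : Q ⟶ U') (q₂ : Q ⟶ V) (k : Q ⟶ V'),
          IsWeakPullbackOn P q₁ q₂ h p₁ ∧ k ≫ p₁' = q₁ ∧ k ≫ p₂' = q₂ ≫ p₂ ∧ k ≫ f' = q₂ ≫ f

/-- The full subcategory on `P` has full diagrams. -/
def HasFullDiagramsOn : Prop :=
  ∀ {X Y : E}, P X → P Y →
    ∃ (U V : E) (_ : P U) (_ : P V) (p₁ : V ⟶ U) (p₂ : V ⟶ X) (f : V ⟶ Y),
      IsFullDiagramOn P p₁ p₂ f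

/-- Weak exponential relative to the full subcategory on `P`. -/
def IsWeakExponentialOn {X Y W V : E} (p₁ : V ⟶ W) (p₂ : V ⟶ X) (e : V ⟶ Y) : Prop :=
  IsWeakProductOn P p₁ p₂ ∧ DeterminedByProjectionsOn P p₁ p₂ e ∧
    ∀ {W' V' : E}, P W' → P V' → ∀ (p₁' : V' ⟶ W') (p₂' : V' ⟶ X) (e' : V' ⟶ Y),
      IsWeakProductOn P p₁' p₂' → DeterminedByProjectionsOn P p₁' p₂' e' →
        ∃ (h : W' ⟶ W) (k : V' ⟶ V), k ≫ p₁ = p₁' ≫ h ∧ k ≫ p₂ = p₂' ∧ k ≫ e = e'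

/-- The full subcategory on `P` has weak exponentials. -/
def HasWeakExponentialsOn : Prop :=
  ∀ {X Y : E}, P X → P Y →
    ∃ (W V : E) (_ : P W) (_ : P V) (p₁ : V ⟶ W) (p₂ : V ⟶ X) (e : V ⟶ Y),
      IsWeakExponentialOn P p₁ p₂ e

/-- Dependent full diagram relative to the full subcategory on `P`. -/
def IsDepFullDiagramOn {J X Y U V : E} (x : X ⟶ J) (y : Y ⟶ X)
    (u : U ⟶ J) (p₁ : V ⟶ U) (p₂ : V ⟶ X) (f : V ⟶ Y) : Prop :=
  IsWeakPullbackOn P p₁ p₂ u x ∧ f ≫ y = p₂ ∧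
    ∀ {U' V' : E}, P U' → P V' → ∀ (u' : U' ⟶ J) (p₁' : V' ⟶ U') (p₂' : V' ⟶ X) (f' : V' ⟶ Y),
      IsWeakPullbackOn P p₁' p₂' u' x → f' ≫ y = p₂' →
        ∃ h : U' ⟶ U, h ≫ u = u' ∧
          ∃ (Q : E) (_ : P Q) (q₁ : Q ⟶ V) (q₂ : Q ⟶ U') (k : Q ⟶ V'),
            IsWeakPullbackOn P q₁ q₂ p₁ h ∧ k ≫ p₁' = q₂ ∧ k ≫ f' = q₁ ≫ f

/-- The full subcategory on `P` has dependent full diagrams. -/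
def HasDepFullDiagramsOn : Prop :=
  ∀ {J X Y : E}, P J → P X → P Y → ∀ (x : X ⟶ J) (y : Y ⟶ X),
    ∃ (U V : E) (_ : P U) (_ : P V) (u : U ⟶ J) (p₁ : V ⟶ U) (p₂ : V ⟶ X) (f : V ⟶ Y),
      IsDepFullDiagramOn P x y u p₁ p₂ f

/-- Weak dependent product relative to the full subcategory on `P`. -/
def IsWeakDepProdOn {J X Y U V : E} (x : X ⟶ J) (y : Y ⟶ X)
    (u : U ⟶ J) (p₁ : V ⟶ U) (p₂ : V ⟶ X) (f : V ⟶ Y) : Prop :=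
  IsWeakPullbackOn P p₁ p₂ u x ∧ f ≫ y = p₂ ∧ DeterminedByProjectionsOn P p₁ p₂ f ∧
    ∀ {U' V' : E}, P U' → P V' → ∀ (u' : U' ⟶ J) (p₁' : V' ⟶ U') (p₂' : V' ⟶ X) (f' : V' ⟶ Y),
      IsWeakPullbackOn P p₁' p₂' u' x → f' ≫ y = p₂' →
        ∃ (h : U' ⟶ U) (k : V' ⟶ V),
          h ≫ u = u' ∧ k ≫ p₁ = p₁' ≫ h ∧ k ≫ p₂ = p₂' ∧ k ≫ f = f'

/-- The full subcategory on `P` has weak dependent products. -/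
def HasWeakDepProdsOn : Prop :=
  ∀ {J X Y : E}, P J → P X → P Y → ∀ (x : X ⟶ J) (y : Y ⟶ X),
    ∃ (U V : E) (_ : P U) (_ : P V) (u : U ⟶ J) (p₁ : V ⟶ U) (p₂ : V ⟶ X) (f : V ⟶ Y),
      IsWeakDepProdOn P x y u p₁ p₂ f

/-- An object over `X` with vertex in the full subcategory on `P`. -/
structure OverIn (X : E) where
  V : E
  hV : P V
  hom : V ⟶ X

/-- The preorder on `OverIn P X` whose poset reflection is the poset reflection
of the slice category of the full subcategory on `P` over `X`. -/
instance {X : E} : Preorder (OverIn P X) where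
  le a b := ∃ t : a.V ⟶ b.V, t ≫ b.hom = a.hom
  le_refl a := ⟨𝟙 _, by simp⟩
  le_trans a b c := by
    rintro ⟨t, ht⟩ ⟨s, hs⟩
    exact ⟨t ≫ s, by simp [Category.assoc, hs, ht]⟩

/-- The full subcategory on `P` has right adjoints to the (poset-reflected)
weak pullback functors along all of its morphisms. -/
def HasRightAdjointsToWeakPullbacksOn : Prop :=
  ∀ {X Y : E}, P X → P Y → ∀ f : Y ⟶ X,
    ∃ wp : OverIn P X → OverIn P Y,
      (∀ a : OverIn P X, ∃ m : (wp a).V ⟶ a.V,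
        IsWeakPullbackOn P m (wp a).hom a.hom f) ∧
      ∃ ra : OverIn P Y → OverIn P X,
        ∀ (a : OverIn P X) (b : OverIn P Y), wp a ≤ b ↔ a ≤ ra b

end Relative

/-- `ev : W ⨯ X ⟶ Y` exhibits `W` as an exponential of `Y` by `X`. -/
def IsExponential [HasBinaryProducts E] (X Y W : E) (ev : W ⨯ X ⟶ Y) : Prop :=
  ∀ {Z : E} (g : Z ⨯ X ⟶ Y), ∃! h : Z ⟶ W, prod.map h (𝟙 X) ≫ ev = g

/-- A category with binary products is cartesian closed if every pair of objects
has an exponential. -/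
def IsCartesianClosed (E : Type u) [Category.{v} E] [HasBinaryProducts E] : Prop :=
  ∀ X Y : E, ∃ (W : E) (ev : W ⨯ X ⟶ Y), IsExponential X Y W ev

/-- A category with finite limits is locally cartesian closed if all its slices
are cartesian closed. -/
def IsLocallyCartesianClosed (E : Type u) [Category.{v} E] [HasFiniteLimits E] : Prop :=
  ∀ X : E, IsCartesianClosed (Over X)

end Paper
namespace Paper

/-- A span in the full subcategory on `P` over the three objects `Z`, `X`, `Y`. -/
structure SpanOver {E : Type u} [Category.{v} E] (P : E → Prop) (Z X Y : E) where
  V : E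
  hV : P V
  toZ : V ⟶ Z
  toX : V ⟶ X
  toY : V ⟶ Y

/-- The preorder on spans over `Z, X, Y` whose antisymmetrization is the poset
reflection of the category of spans in the full subcategory on `P`. -/
instance {E : Type u} [Category.{v} E] (P : E → Prop) (Z X Y : E) :
    Preorder (SpanOver P Z X Y) where
  le a b := ∃ m : a.V ⟶ b.V, m ≫ b.toZ = a.toZ ∧ m ≫ b.toX = a.toX ∧ m ≫ b.toY = a.toY
  le_refl a := ⟨𝟙 _, by simp⟩
  le_trans a b c := by
    rintro ⟨m, hm₁, hm₂, hm₃⟩ ⟨n, hn₁, hn₂, hn₃⟩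
    exact ⟨m ≫ n, by simp [Category.assoc, hn₁, hn₂, hn₃, hm₁, hm₂, hm₃]⟩

/-- In an exact category the regular epimorphisms are exactly the strong ones. -/
theorem nonempty_regularEpi_iff_strongEpi {E : Type u} [Category.{v} E] [ExactCategory E]
    {A B : E} (f : A ⟶ B) : Nonempty (RegularEpi f) ↔ StrongEpi f := by
  constructor
  · intro h
    have : IsRegularEpi f := ⟨h⟩
    infer_instance
  · intro hf
    obtain ⟨I, e, m, ⟨he⟩, hm, rfl⟩ := ExactCategory.regEpiMonoFactorisation f
    have : StrongEpi m := strongEpi_of_strongEpi e m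
    have : IsIso m := isIso_of_mono_of_strongEpi m
    exact ⟨he.ofArrowIso (Arrow.isoMk' e (e ≫ m) (Iso.refl A) (asIso m))⟩

namespace IsProjectiveCover

variable {E : Type u} [Category.{v} E] [ExactCategory E] {P : E → Prop}

theorem exists_lift (hP : IsProjectiveCover P) {W A B : E} (hW : P W) (g : A ⟶ B) [StrongEpi g]
    (f : W ⟶ B) : ∃ f' : W ⟶ A, f' ≫ g = f :=
  hP.1 hW g ((nonempty_regularEpi_iff_strongEpi g).2 inferInstance) f

theorem exists_cover (hP : IsProjectiveCover P) (A : E) :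
    ∃ (W : E) (p : W ⟶ A), P W ∧ StrongEpi p := by
  obtain ⟨W, p, hW, hp⟩ := hP.2 A
  exact ⟨W, p, hW, (nonempty_regularEpi_iff_strongEpi p).1 hp⟩

end IsProjectiveCover

namespace SpanOver

variable {E : Type u} [Category.{v} E] [ExactCategory E] {P : E → Prop} {Z X Y : E}

/-- The morphism into the product induced by the legs of a span. -/
noncomputable def tuple (a : SpanOver P Z X Y) : a.V ⟶ (Z ⨯ X) ⨯ Y :=
  prod.lift (prod.lift a.toZ a.toX) a.toY

/-- The span of components of a morphism into the product. -/
noncomputable def ofTuple {V : E} (hV : P V) (f : V ⟶ (Z ⨯ X) ⨯ Y) : SpanOver P Z X Y :=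
  ⟨V, hV, f ≫ prod.fst ≫ prod.fst, f ≫ prod.fst ≫ prod.snd, f ≫ prod.snd⟩

@[simp]
theorem tuple_ofTuple {V : E} (hV : P V) (f : V ⟶ (Z ⨯ X) ⨯ Y) : (ofTuple hV f).tuple = f := by
  simp only [tuple, ofTuple]
  ext <;> simp [prod.lift_fst, prod.lift_snd]

theorem le_iff_exists_comp_tuple {a b : SpanOver P Z X Y} :
    a ≤ b ↔ ∃ m : a.V ⟶ b.V, m ≫ b.tuple = a.tuple := by
  refine exists_congr fun m => ⟨?_, fun h => ⟨?_, ?_, ?_⟩⟩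
  · rintro ⟨h₁, h₂, h₃⟩
    simp [tuple, prod.comp_lift, h₁, h₂, h₃]
  · simpa [tuple, prod.comp_lift, prod.lift_fst, prod.lift_fst_assoc] using
      h =≫ (prod.fst ≫ prod.fst)
  · simpa [tuple, prod.comp_lift, prod.lift_snd, prod.lift_fst_assoc] using
      h =≫ (prod.fst ≫ prod.snd)
  · simpa [tuple, prod.comp_lift, prod.lift_snd] using h =≫ prod.snd

/-- The span `a` covers the subobject `s`: its induced morphism into the product has image `s`. -/
def Covers (a : SpanOver P Z X Y) (s : Subobject ((Z ⨯ X) ⨯ Y)) : Prop :=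
  ∃ q : a.V ⟶ (s : E), StrongEpi q ∧ q ≫ s.arrow = a.tuple

theorem exists_covers_of_subobject (hP : IsProjectiveCover P) (s : Subobject ((Z ⨯ X) ⨯ Y)) :
    ∃ a : SpanOver P Z X Y, a.Covers s := by
  obtain ⟨V, p, hV, hp⟩ := hP.exists_cover (s : E)
  exact ⟨ofTuple hV (p ≫ s.arrow), p, hp, (tuple_ofTuple _ _).symm⟩

theorem exists_covers (a : SpanOver P Z X Y) : ∃ s, a.Covers s := by
  obtain ⟨I, e, m, he, hm, h⟩ := ExactCategory.regEpiMonoFactorisation a.tuple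
  have : StrongEpi e := (nonempty_regularEpi_iff_strongEpi e).1 he
  exact ⟨Subobject.mk m, e ≫ (Subobject.underlyingIso m).inv, inferInstance, by simpa using h⟩

theorem Covers.le_iff_le (hP : IsProjectiveCover P) {a b : SpanOver P Z X Y}
    {s t : Subobject ((Z ⨯ X) ⨯ Y)} (ha : a.Covers s) (hb : b.Covers t) : a ≤ b ↔ s ≤ t := by
  obtain ⟨p, hp, hpa⟩ := ha
  obtain ⟨q, hq, hqb⟩ := hb
  rw [le_iff_exists_comp_tuple, ← hpa, ← hqb]
  constructor
  · rintro ⟨m, hm⟩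
    have sq : CommSq (m ≫ q) p t.arrow s.arrow := ⟨by simpa using hm⟩
    exact Subobject.le_of_comm sq.lift sq.fac_right
  · intro h
    obtain ⟨m, hm⟩ := hP.exists_lift a.hV q (p ≫ s.ofLE t h)
    exact ⟨m, by rw [← Category.assoc, hm, Category.assoc, Subobject.ofLE_arrow]⟩

theorem Covers.of_antisymmRel (hP : IsProjectiveCover P) {a b : SpanOver P Z X Y}
    {s : Subobject ((Z ⨯ X) ⨯ Y)} (ha : a.Covers s) (hab : AntisymmRel (· ≤ ·) a b) :
    b.Covers s := by
  obtain ⟨t, ht⟩ := b.exists_covers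
  rwa [le_antisymm ((ha.le_iff_le hP ht).1 hab.1) ((ht.le_iff_le hP ha).1 hab.2)]

/-- A span is a weak product exactly when the induced morphism to the product is a strong epi. -/
theorem isWeakProductOn_iff_strongEpi (hP : IsProjectiveCover P) (a : SpanOver P Z X Y) :
    IsWeakProductOn P a.toZ a.toX ↔ StrongEpi (prod.lift a.toZ a.toX) := by
  constructor
  · intro h
    obtain ⟨W, p, hW, hp⟩ := hP.exists_cover (Z ⨯ X)
    obtain ⟨t, ht₁, ht₂⟩ := h hW (p ≫ prod.fst) (p ≫ prod.snd)
    have ht : t ≫ prod.lift a.toZ a.toX = p := by ext <;> simp [ht₁, ht₂, prod.lift_fst, prod.lift_snd]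
    rw [← ht] at hp
    exact strongEpi_of_strongEpi t _
  · intro h W hW f g
    obtain ⟨t, ht⟩ := hP.exists_lift hW (prod.lift a.toZ a.toX) (prod.lift f g)
    exact ⟨t, by simpa [prod.lift_fst] using ht =≫ prod.fst, by simpa [prod.lift_snd] using ht =≫ prod.snd⟩

theorem Covers.regularEpi_iff (hP : IsProjectiveCover P) {a : SpanOver P Z X Y}
    {s : Subobject ((Z ⨯ X) ⨯ Y)} (h : a.Covers s) :
    Nonempty (RegularEpi (s.arrow ≫ prod.fst)) ↔ IsWeakProductOn P a.toZ a.toX := by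
  obtain ⟨q, hq, hqa⟩ := h
  have hfst : q ≫ s.arrow ≫ prod.fst = prod.lift a.toZ a.toX := by
    rw [← Category.assoc, hqa, tuple, prod.lift_fst]
  rw [nonempty_regularEpi_iff_strongEpi, isWeakProductOn_iff_strongEpi hP, ← hfst]
  exact ⟨fun _ => inferInstance, fun _ => strongEpi_of_strongEpi q _⟩

theorem Covers.mono_iff (hP : IsProjectiveCover P) {a : SpanOver P Z X Y}
    {s : Subobject ((Z ⨯ X) ⨯ Y)} (h : a.Covers s) :
    Mono (s.arrow ≫ prod.fst) ↔ DeterminedByProjectionsOn P a.toZ a.toX a.toY := by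
  obtain ⟨q, hq, hqa⟩ := h
  have hZ : q ≫ s.arrow ≫ prod.fst ≫ prod.fst = a.toZ := by
    rw [← Category.assoc, hqa]; simp [tuple, prod.lift_fst, prod.lift_fst_assoc]
  have hX : q ≫ s.arrow ≫ prod.fst ≫ prod.snd = a.toX := by
    rw [← Category.assoc, hqa]; simp [tuple, prod.lift_snd, prod.lift_fst_assoc]
  have hY : q ≫ s.arrow ≫ prod.snd = a.toY := by
    rw [← Category.assoc, hqa]; simp [tuple, prod.lift_snd]
  constructor
  · intro _ W _ f g h₁ h₂
    have hfg : f ≫ q = g ≫ q := by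
      rw [← cancel_mono (s.arrow ≫ prod.fst)]
      ext
      · simpa [hZ] using h₁
      · simpa [hX] using h₂
    simpa [hY] using hfg =≫ (s.arrow ≫ prod.snd)
  · refine fun hdet => ⟨fun {T} g k hgk => ?_⟩
    obtain ⟨W, w, hW, hw⟩ := hP.exists_cover T
    obtain ⟨g', hg'⟩ := hP.exists_lift hW q (w ≫ g)
    obtain ⟨k', hk'⟩ := hP.exists_lift hW q (w ≫ k)
    have hfst : g' ≫ q ≫ s.arrow ≫ prod.fst = k' ≫ q ≫ s.arrow ≫ prod.fst := by
      rw [← Category.assoc, hg', ← Category.assoc k', hk', Category.assoc, hgk, Category.assoc]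
    have hsnd := hdet hW g' k'
      (by rw [← hZ]; simpa using hfst =≫ prod.fst)
      (by rw [← hX]; simpa using hfst =≫ prod.snd)
    rw [← hY] at hsnd
    rw [← cancel_epi w, ← hg', ← hk', ← cancel_mono s.arrow]
    apply Limits.prod.hom_ext
    · simpa using hfst
    · simpa using hsnd

theorem Covers.isIso_iff (hP : IsProjectiveCover P) {a : SpanOver P Z X Y}
    {s : Subobject ((Z ⨯ X) ⨯ Y)} (h : a.Covers s) :
    IsIso (s.arrow ≫ prod.fst) ↔
      (IsWeakProductOn P a.toZ a.toX ∧ DeterminedByProjectionsOn P a.toZ a.toX a.toY) := by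
  rw [← h.regularEpi_iff hP, ← h.mono_iff hP, nonempty_regularEpi_iff_strongEpi]
  exact ⟨fun _ => ⟨inferInstance, inferInstance⟩, fun ⟨_, _⟩ => isIso_of_mono_of_strongEpi _⟩

end SpanOver

/-- For a projective cover `P` of an exact category `E` and
objects `Z, X, Y` of `P`, the subobject poset of `Z ⨯ X ⨯ Y` in `E` is
isomorphic to the poset reflection of the category of spans in `P` over
`Z, X, Y`; the isomorphism restricts between the subobjects whose composite to
`Z ⨯ X` is a regular epi (resp. an iso) and the spans whose first two legs form
a weak product (resp. a weak product together with a third leg determined by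
projections). -/
theorem subobject_orderIso_spans
    {E : Type u} [Category.{v} E] [ExactCategory E]
    (P : E → Prop) (hP : IsProjectiveCover P)
    {Z X Y : E} (hZ : P Z) (hX : P X) (hY : P Y) :
    ∃ e : Subobject ((Z ⨯ X) ⨯ Y) ≃o
        Antisymmetrization (SpanOver P Z X Y) (· ≤ ·),
      (∀ (s : Subobject ((Z ⨯ X) ⨯ Y)) (a : SpanOver P Z X Y),
        e s = toAntisymmetrization (α := SpanOver P Z X Y) (· ≤ ·) a →
          (Nonempty (RegularEpi (s.arrow ≫ prod.fst)) ↔ IsWeakProductOn P a.toZ a.toX)) ∧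
      (∀ (s : Subobject ((Z ⨯ X) ⨯ Y)) (a : SpanOver P Z X Y),
        e s = toAntisymmetrization (α := SpanOver P Z X Y) (· ≤ ·) a →
          (IsIso (s.arrow ≫ prod.fst) ↔
            (IsWeakProductOn P a.toZ a.toX ∧
              DeterminedByProjectionsOn P a.toZ a.toX a.toY))) := by
  choose c hc using SpanOver.exists_covers_of_subobject (Z := Z) (X := X) (Y := Y) hP
  let e₀ : Subobject ((Z ⨯ X) ⨯ Y) ↪o Antisymmetrization (SpanOver P Z X Y) (· ≤ ·) :=
    OrderEmbedding.ofMapLEIff (fun s => toAntisymmetrization (· ≤ ·) (c s)) fun s t =>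
      toAntisymmetrization_le_toAntisymmetrization_iff.trans ((hc s).le_iff_le hP (hc t))
  have hsurj : Function.Surjective e₀ := by
    intro x
    induction x using Antisymmetrization.ind with
    | _ a =>
      obtain ⟨s, hs⟩ := a.exists_covers
      exact ⟨s, Quotient.sound
        ⟨((hc s).le_iff_le hP hs).2 le_rfl, (hs.le_iff_le hP (hc s)).2 le_rfl⟩⟩
  have covers (s : Subobject ((Z ⨯ X) ⨯ Y)) (a : SpanOver P Z X Y)
      (h : e₀ s = toAntisymmetrization (· ≤ ·) a) : a.Covers s :=
    (hc s).of_antisymmRel hP (Quotient.exact h)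
  exact ⟨RelIso.ofSurjective e₀ hsurj, fun s a h => (covers s a h).regularEpi_iff hP,
    fun s a h => (covers s a h).isIso_iff hP⟩

end Paper
end
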